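/- Let δ ≥ 1, let N be an admissible norm with constant C_N, and let H_p, H_q be proper, geodesically complete, δ-hyperbolic, Busemann spaces. Then the horospherical product H = H_p⋈H_q is connected; more precisely, any two points x = (x_p,x_q) and y = (y_p,y_q) of H are joined by a connected path in H of l_N-length at most 2C_N(d_{H_p}(x_p,y_p) + d_{H_q}(x_q,y_q)), and consequently ½(d_{H_p}(x_p,y_p) + d_{H_q}(x_q,y_q)) ≤ d_{H,N}(x,y) ≤ 2C_N(d_{H_p}(x_p,y_p) + d_{H_q}(x_q,y_q)). -/

import Mathlib

open Set Filter
open scoped ENNReal NNReal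

noncomputable section

namespace HP

variable {H : Type*} [MetricSpace H]

/-- `γ` restricted to `I` is an arclength-parametrised (isometric) geodesic. -/
def IsGeodesicOn (γ : ℝ → H) (I : Set ℝ) : Prop :=
  ∀ s ∈ I, ∀ t ∈ I, dist (γ s) (γ t) = |s - t|

/-- A geodesic line of `H`. -/
def IsGeodesicLine (γ : ℝ → H) : Prop := IsGeodesicOn γ Set.univ

/-- A geodesic ray of `H`, parametrised on `[0,∞)`. -/
def IsGeodesicRay (γ : ℝ → H) : Prop := IsGeodesicOn γ (Set.Ici 0)

/-- A geodesic ray starting at `w`. -/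
def IsRayFrom (w : H) (γ : ℝ → H) : Prop := IsGeodesicRay γ ∧ γ 0 = w

/-- A geodesic segment from `x` to `y`, parametrised on `[0, dist x y]`. -/
def IsGeodSegment (γ : ℝ → H) (x y : H) : Prop :=
  IsGeodesicOn γ (Set.Icc 0 (dist x y)) ∧ γ 0 = x ∧ γ (dist x y) = y

/-- The traces on `[0,∞)` of two rays are at finite Hausdorff distance. -/
def FinHausRays (γ₁ γ₂ : ℝ → H) : Prop :=
  ∃ C : ℝ, (∀ s : ℝ, 0 ≤ s → ∃ t : ℝ, 0 ≤ t ∧ dist (γ₁ s) (γ₂ t) ≤ C) ∧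
           (∀ t : ℝ, 0 ≤ t → ∃ s : ℝ, 0 ≤ s ∧ dist (γ₁ s) (γ₂ t) ≤ C)

/-- A geodesic metric space: any two points are joined by a geodesic segment. -/
def GeodesicSpace (H : Type*) [MetricSpace H] : Prop :=
  ∀ x y : H, ∃ γ : ℝ → H, IsGeodSegment γ x y

/-- `δ`-hyperbolicity: geodesic space all of whose geodesic triangles are `δ`-slim,
i.e. each side is contained in the `δ`-neighbourhood of the union of the other two. -/
def DeltaHyperbolic (H : Type*) [MetricSpace H] (δ : ℝ) : Prop :=
  GeodesicSpace H ∧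
  ∀ x y z : H, ∀ γ₁ γ₂ γ₃ : ℝ → H,
    IsGeodSegment γ₁ x y → IsGeodSegment γ₂ y z → IsGeodSegment γ₃ z x →
    ∀ s ∈ Set.Icc (0:ℝ) (dist x y),
      ∃ u ∈ γ₂ '' Set.Icc (0:ℝ) (dist y z) ∪ γ₃ '' Set.Icc (0:ℝ) (dist z x),
        dist (γ₁ s) u ≤ δ

/-- A Busemann space: geodesic, and the distance between any two
arclength-parametrised geodesics is a convex function. -/
def BusemannSpace (H : Type*) [MetricSpace H] : Prop :=
  GeodesicSpace H ∧
  ∀ (a b a' b' : ℝ) (γ γ' : ℝ → H),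
    IsGeodesicOn γ (Set.Icc a b) → IsGeodesicOn γ' (Set.Icc a' b') →
    ConvexOn ℝ (Set.Icc a b ×ˢ Set.Icc a' b')
      (fun p : ℝ × ℝ => dist (γ p.1) (γ' p.2))

/-- Geodesic completeness: every geodesic segment extends to a geodesic line. -/
def GeodesicallyComplete (H : Type*) [MetricSpace H] : Prop :=
  ∀ (a b : ℝ) (γ : ℝ → H), a ≤ b → IsGeodesicOn γ (Set.Icc a b) →
    ∃ γ' : ℝ → H, IsGeodesicLine γ' ∧ ∀ t ∈ Set.Icc a b, γ' t = γ t

/-- The Busemann function with respect to the boundary point represented by the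
geodesic ray `aRep` and the base point `w`. -/
def busemann (w : H) (aRep : ℝ → H) (x : H) : ℝ :=
  sSup { b : ℝ | ∃ k : ℝ → H, IsRayFrom w k ∧ FinHausRays aRep k ∧
    b = Filter.limsup (fun t => dist x (k t) - t) Filter.atTop }

/-- The height function: minus the Busemann function. -/
def height (w : H) (aRep : ℝ → H) (x : H) : ℝ := - busemann w aRep x

/-- A vertical geodesic (forward oriented): a geodesic line whose height tends to `+∞`. -/
def IsVerticalGeodesic (w : H) (aRep : ℝ → H) (V : ℝ → H) : Prop :=
  IsGeodesicLine V ∧ Tendsto (fun t => height w aRep (V t)) atTop atTop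

/-- A vertical geodesic line (either orientation): a geodesic line whose image lies
in the boundary class, i.e. whose height tends to `+∞` along one of its ends. -/
def IsVerticalGeodesicLine (w : H) (aRep : ℝ → H) (V : ℝ → H) : Prop :=
  IsGeodesicLine V ∧
    (Tendsto (fun t => height w aRep (V t)) atTop atTop ∨
     Tendsto (fun t => height w aRep (V t)) atBot atTop)

/-- A vertical geodesic parametrised by its height: `h(V(t)) = t` for all `t`. -/
def VertParam (w : H) (aRep : ℝ → H) (V : ℝ → H) : Prop :=
  IsGeodesicLine V ∧ ∀ t : ℝ, height w aRep (V t) = t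

/-- Height difference `Δh(x,y)`. -/
def dh (w : H) (aRep : ℝ → H) (x y : H) : ℝ :=
  |height w aRep x - height w aRep y|

/-- Relative distance `d_r(x,y) = d(x,y) - Δh(x,y)`. -/
def dr (w : H) (aRep : ℝ → H) (x y : H) : ℝ := dist x y - dh w aRep x y

/-- Maximal height `h⁺` of a path along the parameter set `I`. -/
def hplusOn (w : H) (aRep : ℝ → H) (γ : ℝ → H) (I : Set ℝ) : ℝ :=
  sSup ((fun t => height w aRep (γ t)) '' I)

/-- Minimal height `h⁻` of a path along the parameter set `I`. -/
def hminusOn (w : H) (aRep : ℝ → H) (γ : ℝ → H) (I : Set ℝ) : ℝ :=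
  sInf ((fun t => height w aRep (γ t)) '' I)

/-- A path parametrised by arclength: the length of the piece on `[s,t]` equals `t - s`. -/
def ArclengthPath (V : ℝ → H) : Prop :=
  ∀ s t : ℝ, s ≤ t → eVariationOn V (Set.Icc s t) = ENNReal.ofReal (t - s)

/-- An admissible norm on `ℝ²`: a norm with `N(1,1) = 1` and `N(a,b) ≥ (a+b)/2`. -/
structure AdmNorm where
  toFun : ℝ × ℝ → ℝ
  eq_zero_iff : ∀ v : ℝ × ℝ, toFun v = 0 ↔ v = 0
  smul_eq : ∀ (c : ℝ) (v : ℝ × ℝ), toFun (c • v) = |c| * toFun v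
  add_le : ∀ v w : ℝ × ℝ, toFun (v + w) ≤ toFun v + toFun w
  one_one : toFun (1, 1) = 1
  adm : ∀ a b : ℝ, (a + b) / 2 ≤ toFun (a, b)

/-- `C` is a comparison constant `C_N` for the admissible norm `N`:
`C ≥ 1` and `N(a,b) ≤ C(a+b)/2` for all `a,b ≥ 0`. -/
def AdmNorm.BoundConst (N : AdmNorm) (C : ℝ) : Prop :=
  1 ≤ C ∧ ∀ a b : ℝ, 0 ≤ a → 0 ≤ b → N.toFun (a, b) ≤ C * (a + b) / 2

variable {Hp Hq : Type*} [MetricSpace Hp] [MetricSpace Hq]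

/-- Membership in the horospherical product: `h_p(x_p) + h_q(x_q) = 0`. -/
def inHoro (wp : Hp) (ap : ℝ → Hp) (wq : Hq) (aq : ℝ → Hq) (z : Hp × Hq) : Prop :=
  height wp ap z.1 + height wq aq z.2 = 0

/-- The `N`-length of a path in `Hp × Hq`: supremum over finite monotone
subdivisions of the sums of the `N(d_p, d_q)`-distances. -/
def lN (Nf : ℝ × ℝ → ℝ) (γ : ℝ → Hp × Hq) (s : Set ℝ) : ℝ≥0∞ :=
  ⨆ p : ℕ × { u : ℕ → ℝ // Monotone u ∧ ∀ i, u i ∈ s },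
    ∑ i ∈ Finset.range p.1,
      ENNReal.ofReal (Nf (dist (γ (p.2.1 (i+1))).1 (γ (p.2.1 i)).1,
                          dist (γ (p.2.1 (i+1))).2 (γ (p.2.1 i)).2))

/-- The `N`-path metric: infimum of `N`-lengths of connected paths staying in the
horospherical product and joining the two points. -/
def dHN (Nf : ℝ × ℝ → ℝ) (mem : Hp × Hq → Prop) (x y : Hp × Hq) : ℝ≥0∞ :=
  ⨅ (T : ℝ) (_ : 0 ≤ T) (γ : ℝ → Hp × Hq) (_ : ContinuousOn γ (Set.Icc 0 T))
    (_ : ∀ t ∈ Set.Icc (0:ℝ) T, mem (γ t)) (_ : γ 0 = x) (_ : γ T = y),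
    lN Nf γ (Set.Icc 0 T)

/-- A geodesic of the horospherical product with respect to the `N`-path metric,
parametrised (by arclength) on `I` and staying in the product. -/
def IsHNGeodesicOn (Nf : ℝ × ℝ → ℝ) (mem : Hp × Hq → Prop)
    (α : ℝ → Hp × Hq) (I : Set ℝ) : Prop :=
  (∀ t ∈ I, mem (α t)) ∧
  ∀ s ∈ I, ∀ t ∈ I, dHN Nf mem (α s) (α t) = ENNReal.ofReal |s - t|

/-- A vertical geodesic of the horospherical product, parametrised by its height. -/
def IsHNVerticalLine (Nf : ℝ × ℝ → ℝ) (mem : Hp × Hq → Prop)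
    (wp : Hp) (ap : ℝ → Hp) (V : ℝ → Hp × Hq) : Prop :=
  IsHNGeodesicOn Nf mem V Set.univ ∧ ∀ t : ℝ, height wp ap (V t).1 = t

/-- Maximal height `h⁺` of a path of the horospherical product. -/
def hplusH (wp : Hp) (ap : ℝ → Hp) (γ : ℝ → Hp × Hq) (I : Set ℝ) : ℝ :=
  sSup ((fun t => height wp ap (γ t).1) '' I)

/-- Minimal height `h⁻` of a path of the horospherical product. -/
def hminusH (wp : Hp) (ap : ℝ → Hp) (γ : ℝ → Hp × Hq) (I : Set ℝ) : ℝ :=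
  sInf ((fun t => height wp ap (γ t).1) '' I)

/-- `H_p`-type path at scale `κ`: the first component stays `κ`-close to a geodesic
of `H_p` and the second component stays `κ`-close to a vertical geodesic of `H_q`. -/
def IsHpType (wq : Hq) (aq : ℝ → Hq) (κ : ℝ) (α : ℝ → Hp × Hq) : Prop :=
  (∃ g : ℝ → Hp, IsGeodesicLine g ∧ ∀ t : ℝ, ∃ s : ℝ, dist (α t).1 (g s) ≤ κ) ∧
  (∃ v : ℝ → Hq, IsVerticalGeodesicLine wq aq v ∧ ∀ t : ℝ, ∃ s : ℝ, dist (α t).2 (v s) ≤ κ)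

/-- `H_q`-type path at scale `κ`. -/
def IsHqType (wp : Hp) (ap : ℝ → Hp) (κ : ℝ) (α : ℝ → Hp × Hq) : Prop :=
  (∃ g : ℝ → Hq, IsGeodesicLine g ∧ ∀ t : ℝ, ∃ s : ℝ, dist (α t).2 (g s) ≤ κ) ∧
  (∃ v : ℝ → Hp, IsVerticalGeodesicLine wp ap v ∧ ∀ t : ℝ, ∃ s : ℝ, dist (α t).1 (v s) ≤ κ)

/-- Finite Hausdorff distance on `[0,∞)` between two rays, for a generalized
(`ℝ≥0∞`-valued) distance `dd`. -/
def HNFinHaus {X : Type*} (dd : X → X → ℝ≥0∞) (α β : ℝ → X) : Prop :=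
  ∃ C : ℝ, (∀ s : ℝ, 0 ≤ s → ∃ t : ℝ, 0 ≤ t ∧ dd (α s) (β t) ≤ ENNReal.ofReal C) ∧
           (∀ t : ℝ, 0 ≤ t → ∃ s : ℝ, 0 ≤ s ∧ dd (α s) (β t) ≤ ENNReal.ofReal C)

theorem finHaus_equivalence (H : Type*) [MetricSpace H] :
    Equivalence (fun γ₁ γ₂ : {γ : ℝ → H // IsGeodesicRay γ} => FinHausRays γ₁.1 γ₂.1) := by
  constructor
  · intro γ
    exact ⟨0, fun s hs => ⟨s, hs, by simp⟩, fun t ht => ⟨t, ht, by simp⟩⟩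
  · rintro γ₁ γ₂ ⟨C, h1, h2⟩
    refine ⟨C, fun s hs => ?_, fun t ht => ?_⟩
    · obtain ⟨u, hu, hd⟩ := h2 s hs
      exact ⟨u, hu, by rwa [dist_comm]⟩
    · obtain ⟨u, hu, hd⟩ := h1 t ht
      exact ⟨u, hu, by rwa [dist_comm]⟩
  · rintro γ₁ γ₂ γ₃ ⟨C, h1, h2⟩ ⟨D, g1, g2⟩
    refine ⟨C + D, fun s hs => ?_, fun t ht => ?_⟩
    · obtain ⟨u, hu, hd⟩ := h1 s hs
      obtain ⟨v, hv, he⟩ := g1 u hu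
      exact ⟨v, hv, (dist_triangle _ (γ₂.1 u) _).trans (add_le_add hd he)⟩
    · obtain ⟨u, hu, hd⟩ := g2 t ht
      obtain ⟨v, hv, he⟩ := h2 u hu
      exact ⟨v, hv, (dist_triangle _ (γ₂.1 u) _).trans (add_le_add he hd)⟩

/-- The setoid of geodesic rays up to finite Hausdorff distance. -/
instance raySetoid (H : Type*) [MetricSpace H] : Setoid {γ : ℝ → H // IsGeodesicRay γ} :=
  ⟨fun γ₁ γ₂ => FinHausRays γ₁.1 γ₂.1, finHaus_equivalence H⟩

/-- The Gromov boundary: equivalence classes of geodesic rays at finite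
Hausdorff distance. -/
abbrev Bdry (H : Type*) [MetricSpace H] := Quotient (raySetoid H)

/-- The boundary point determined by a geodesic ray. -/
def bdryPt {H : Type*} [MetricSpace H] (γ : ℝ → H) (h : IsGeodesicRay γ) : Bdry H :=
  Quotient.mk (raySetoid H) ⟨γ, h⟩

/-- The set `((∂H_p ∖ {a_p}) × {a_q}) ∪ ({a_p} × (∂H_q ∖ {a_q}))`. -/
def bdryTarget {Hp Hq : Type*} [MetricSpace Hp] [MetricSpace Hq]
    (ap : ℝ → Hp) (hap : IsGeodesicRay ap)
    (aq : ℝ → Hq) (haq : IsGeodesicRay aq) : Set (Bdry Hp × Bdry Hq) :=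
  ((({bdryPt ap hap} : Set (Bdry Hp))ᶜ ×ˢ ({bdryPt aq haq} : Set (Bdry Hq))) ∪
   (({bdryPt ap hap} : Set (Bdry Hp)) ×ˢ ({bdryPt aq haq} : Set (Bdry Hq))ᶜ))

section Rays

variable {X : Type*} [MetricSpace X]

/-- In a Busemann space, two asymptotic rays with the same origin coincide. -/
theorem IsRayFrom.eq_of_finHausRays (hB : BusemannSpace X) {w : X} {k₁ k₂ : ℝ → X}
    (h₁ : IsRayFrom w k₁) (h₂ : IsRayFrom w k₂) (h : FinHausRays k₁ k₂) {s : ℝ} (hs : 0 ≤ s) :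
    k₁ s = k₂ s := by
  obtain ⟨C, hC, -⟩ := h
  have bounded : ∀ u, 0 ≤ u → dist (k₁ u) (k₂ u) ≤ 2 * C := by
    intro u hu
    obtain ⟨t, ht, hd⟩ := hC u hu
    have e₁ : dist (k₁ u) w = u := by
      rw [← h₁.2, h₁.1 u hu 0 (mem_Ici.2 le_rfl), sub_zero, abs_of_nonneg hu]
    have e₂ : dist (k₂ t) w = t := by
      rw [← h₂.2, h₂.1 t ht 0 (mem_Ici.2 le_rfl), sub_zero, abs_of_nonneg ht]
    have e₃ : dist (k₂ t) (k₂ u) = |t - u| := h₂.1 t ht u hu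
    have e₄ : |t - u| ≤ dist (k₁ u) (k₂ t) := by
      have := abs_dist_sub_le (k₁ u) (k₂ t) w
      rwa [e₁, e₂, abs_sub_comm] at this
    linarith [dist_triangle (k₁ u) (k₂ t) (k₂ u)]
  have scaled : ∀ T, s ≤ T → T * dist (k₁ s) (k₂ s) ≤ s * (2 * C) := by
    intro T hT
    rcases hs.eq_or_lt with rfl | hs'
    · rw [h₁.2, h₂.2]; simp
    have hT0 : 0 < T := hs'.trans_le hT
    have sub : ∀ k : ℝ → X, IsRayFrom w k → IsGeodesicOn k (Icc 0 T) :=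
      fun k hk u hu v hv => hk.1 u hu.1 v hv.1
    have h0 : ((0 : ℝ), (0 : ℝ)) ∈ Icc 0 T ×ˢ Icc 0 T := ⟨⟨le_rfl, hT0.le⟩, ⟨le_rfl, hT0.le⟩⟩
    have h1 : (T, T) ∈ Icc 0 T ×ˢ Icc 0 T := ⟨⟨hT0.le, le_rfl⟩, ⟨hT0.le, le_rfl⟩⟩
    have ha : 0 ≤ 1 - s / T := sub_nonneg.2 ((div_le_one hT0).2 hT)
    have hb : 0 ≤ s / T := by positivity
    have conv := (hB.2 0 T 0 T k₁ k₂ (sub k₁ h₁) (sub k₂ h₂)).2 h0 h1 ha hb (by ring)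
    have hsT : s / T * T = s := by field_simp
    simp only [Prod.smul_mk, Prod.mk_add_mk, smul_eq_mul, mul_zero, zero_add, hsT, h₁.2, h₂.2,
      dist_self] at conv
    calc T * dist (k₁ s) (k₂ s) ≤ T * (s / T * dist (k₁ T) (k₂ T)) := by gcongr
      _ = s * dist (k₁ T) (k₂ T) := by field_simp
      _ ≤ s * (2 * C) := by gcongr; exact bounded T hT0.le
  by_contra hne
  have hpos : 0 < dist (k₁ s) (k₂ s) := dist_pos.2 hne
  have h₀ := scaled (max s (s * (2 * C) / dist (k₁ s) (k₂ s) + 1)) (le_max_left _ _)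
  have h₃ : (s * (2 * C) / dist (k₁ s) (k₂ s) + 1) * dist (k₁ s) (k₂ s) ≤ s * (2 * C) :=
    (mul_le_mul_of_nonneg_right (le_max_right _ _) hpos.le).trans h₀
  rw [add_mul, div_mul_cancel₀ _ hpos.ne'] at h₃
  linarith

/-- Along the chosen ray, the functions `d(x, a(t)) - t` converge. -/
theorem IsRayFrom.exists_tendsto_dist_sub {w : X} {a : ℝ → X} (ha : IsRayFrom w a) (x : X) :
    ∃ b, Tendsto (fun t => dist x (a t) - t) atTop (nhds b) := by
  have anti : Antitone (fun t : ℝ => dist x (a (max t 0)) - max t 0) := by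
    intro s t hst
    have hm : max s 0 ≤ max t 0 := max_le_max_right 0 hst
    have e := ha.1 (max s 0) (mem_Ici.2 (le_max_right _ _)) (max t 0) (mem_Ici.2 (le_max_right _ _))
    rw [abs_sub_comm, abs_of_nonneg (sub_nonneg.2 hm)] at e
    have := dist_triangle x (a (max s 0)) (a (max t 0))
    dsimp only
    linarith
  have bdd : BddBelow (range fun t : ℝ => dist x (a (max t 0)) - max t 0) := by
    refine ⟨-dist x w, ?_⟩
    rintro _ ⟨t, rfl⟩
    have e := ha.1 0 (mem_Ici.2 le_rfl) (max t 0) (mem_Ici.2 (le_max_right _ _))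
    rw [zero_sub, abs_neg, abs_of_nonneg (le_max_right t 0), ha.2] at e
    have := dist_triangle w x (a (max t 0))
    rw [dist_comm w x] at this
    dsimp only
    linarith
  refine ⟨_, (tendsto_atTop_ciInf anti bdd).congr' ?_⟩
  filter_upwards [eventually_ge_atTop (0 : ℝ)] with t ht
  rw [max_eq_left ht]

/-- In a Busemann space the Busemann function is a limit along the chosen ray. -/
theorem tendsto_busemann (hB : BusemannSpace X) {w : X} {a : ℝ → X} (ha : IsRayFrom w a) (x : X) :
    Tendsto (fun t => dist x (a t) - t) atTop (nhds (busemann w a x)) := by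
  obtain ⟨b, hb⟩ := ha.exists_tendsto_dist_sub x
  have hset : { b : ℝ | ∃ k : ℝ → X, IsRayFrom w k ∧ FinHausRays a k ∧
      b = Filter.limsup (fun t => dist x (k t) - t) Filter.atTop } = {b} := by
    ext c
    constructor
    · rintro ⟨k, hk, hak, rfl⟩
      rw [mem_singleton_iff, ← hb.limsup_eq]
      refine limsup_congr ?_
      filter_upwards [eventually_ge_atTop (0 : ℝ)] with t ht
      rw [ha.eq_of_finHausRays hB hk hak ht]
    · rintro rfl
      exact ⟨a, ha, ⟨0, fun s hs => ⟨s, hs, by simp⟩, fun t ht => ⟨t, ht, by simp⟩⟩,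
        hb.limsup_eq.symm⟩
  rwa [busemann, hset, csSup_singleton]

theorem abs_height_sub_le (hB : BusemannSpace X) {w : X} {a : ℝ → X} (ha : IsRayFrom w a)
    (x y : X) : |height w a x - height w a y| ≤ dist x y := by
  have h := ((tendsto_busemann hB ha y).sub (tendsto_busemann hB ha x)).abs
  have e : height w a x - height w a y = busemann w a y - busemann w a x := by
    simp only [height]; ring
  rw [e]
  refine le_of_tendsto h (Eventually.of_forall fun t => ?_)
  rw [sub_sub_sub_cancel_right, dist_comm x y]
  exact abs_dist_sub_le y x (a t)

/-- Every point of a proper, geodesically complete Busemann space lies on a geodesic line along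
which the height grows at unit speed. -/
theorem exists_vertParam [ProperSpace X] (hB : BusemannSpace X) (hG : GeodesicallyComplete X)
    {w : X} {a : ℝ → X} (ha : IsRayFrom w a) (x : X) :
    ∃ V : ℝ → X, VertParam w a V ∧ V (height w a x) = x := by
  have lines : ∀ n : ℕ, ∃ L : ℝ → X, IsGeodesicLine L ∧ L 0 = x ∧
      L (dist x (a n)) = a n := by
    intro n
    obtain ⟨γ, hγ, h₀, h₁⟩ := hB.1 x (a n)
    obtain ⟨L, hL, hLγ⟩ := hG 0 (dist x (a n)) γ dist_nonneg hγ
    exact ⟨L, hL, by rw [hLγ 0 ⟨le_rfl, dist_nonneg⟩, h₀],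
      by rw [hLγ _ ⟨dist_nonneg, le_rfl⟩, h₁]⟩
  choose L hL hL₀ hL₁ using lines
  let U : Ultrafilter ℕ := hyperfilter ℕ
  have hU : (U : Filter ℕ) ≤ atTop := Nat.hyperfilter_le_atTop
  have limits : ∀ t : ℝ, ∃ z : X, Tendsto (fun n => L n t) U (nhds z) := by
    intro t
    have hmem : ∀ n, L n t ∈ Metric.closedBall x |t| := by
      intro n
      rw [Metric.mem_closedBall, ← hL₀ n, hL n t (mem_univ _) 0 (mem_univ _), sub_zero]
    obtain ⟨z, -, hz⟩ := (isCompact_closedBall x |t|).ultrafilter_le_nhds'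
      (U.map fun n => L n t)
      (Filter.eventually_map.2 (Eventually.of_forall hmem))
    exact ⟨z, hz⟩
  choose l hl using limits
  have line : IsGeodesicLine l := by
    intro s _ t _
    refine tendsto_nhds_unique ((hl s).dist (hl t)) (tendsto_const_nhds.congr fun n => ?_)
    exact (hL n s (mem_univ _) t (mem_univ _)).symm
  have hl₀ : l 0 = x :=
    tendsto_nhds_unique (hl 0) (tendsto_const_nhds.congr fun n => (hL₀ n).symm)
  have cast_tendsto : Tendsto (fun n : ℕ => (n : ℝ)) U atTop :=
    tendsto_natCast_atTop_atTop.mono_left hU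
  have bus : ∀ t, busemann w a (l t) = busemann w a x - t := by
    intro t
    have hx := (tendsto_busemann hB ha x).comp cast_tendsto
    have ht := (tendsto_busemann hB ha (l t)).comp cast_tendsto
    have herr : Tendsto (fun n => dist (L n t) (a n) - dist (l t) (a n)) U (nhds 0) := by
      refine squeeze_zero_norm (fun n => ?_) (tendsto_iff_dist_tendsto_zero.1 (hl t))
      exact abs_dist_sub_le (L n t) (l t) (a n)
    refine tendsto_nhds_unique (by simpa using ht.add herr)
      ((hx.sub (tendsto_const_nhds (x := t))).congr' ?_)
    have hlarge : ∀ᶠ n : ℕ in U, t + dist x w ≤ n :=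
      cast_tendsto.eventually (eventually_ge_atTop _)
    filter_upwards [hlarge] with n hn
    have e := ha.1 n (mem_Ici.2 n.cast_nonneg) 0 (mem_Ici.2 le_rfl)
    rw [sub_zero, abs_of_nonneg n.cast_nonneg, ha.2] at e
    have htri := dist_triangle (a n) x w
    rw [dist_comm (a n) x] at htri
    have d := hL n t (mem_univ _) (dist x (a n)) (mem_univ _)
    rw [hL₁ n, abs_sub_comm, abs_of_nonneg (by linarith)] at d
    simp only [Function.comp_apply]
    linarith
  refine ⟨fun t => l (t - height w a x), ⟨fun s _ t _ => ?_, fun t => ?_⟩, ?_⟩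
  · rw [line _ (mem_univ _) _ (mem_univ _)]
    congr 1
    ring
  · rw [height, bus, height]
    ring
  · simp only [sub_self, hl₀]

end Rays

section Paths

variable {X : Type*} [PseudoMetricSpace X]

/-- Two points are joined inside `S` by a `1`-Lipschitz path parametrised by `[0, L]`. -/
def JoinedByShortPath (S : Set X) (x y : X) (L : ℝ) : Prop :=
  ∃ γ : ℝ → X, LipschitzOnWith 1 γ (Icc 0 L) ∧ MapsTo γ (Icc 0 L) S ∧ γ 0 = x ∧ γ L = y

theorem JoinedByShortPath.trans {S : Set X} {x y z : X} {L M : ℝ} (hL : 0 ≤ L) (hM : 0 ≤ M)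
    (hxy : JoinedByShortPath S x y L) (hyz : JoinedByShortPath S y z M) :
    JoinedByShortPath S x z (L + M) := by
  obtain ⟨α, hα, hαS, hα₀, hα₁⟩ := hxy
  obtain ⟨β, hβ, hβS, hβ₀, hβ₁⟩ := hyz
  have left : ∀ t, t ≤ L → (if t ≤ L then α t else β (t - L)) = α t := fun t ht => if_pos ht
  have right : ∀ t, L ≤ t → (if t ≤ L then α t else β (t - L)) = β (t - L) := by
    intro t ht
    rcases ht.eq_or_lt with rfl | ht
    · rw [if_pos le_rfl, hα₁, sub_self, hβ₀]
    · exact if_neg ht.not_ge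
  have dist_α : ∀ s ∈ Icc 0 L, ∀ t ∈ Icc 0 L, dist (α s) (α t) ≤ |s - t| := by
    intro s hs t ht
    simpa [Real.dist_eq] using hα.dist_le_mul s hs t ht
  have dist_β : ∀ s ∈ Icc 0 M, ∀ t ∈ Icc 0 M, dist (β s) (β t) ≤ |s - t| := by
    intro s hs t ht
    simpa [Real.dist_eq] using hβ.dist_le_mul s hs t ht
  refine ⟨fun t => if t ≤ L then α t else β (t - L), ?_, ?_, ?_, ?_⟩
  · have ordered : ∀ s ∈ Icc 0 (L + M), ∀ t ∈ Icc 0 (L + M), s ≤ t →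
        dist (if s ≤ L then α s else β (s - L)) (if t ≤ L then α t else β (t - L)) ≤ t - s := by
      intro s hs t ht hst
      rcases le_total t L with htL | htL
      · rw [left s (hst.trans htL), left t htL]
        have := dist_α s ⟨hs.1, hst.trans htL⟩ t ⟨ht.1, htL⟩
        rwa [abs_sub_comm, abs_of_nonneg (sub_nonneg.2 hst)] at this
      · rw [right t htL]
        have hβt : t - L ∈ Icc 0 M := ⟨by linarith, by linarith [ht.2]⟩
        rcases le_total s L with hsL | hsL
        · rw [left s hsL]
          have h₁ := dist_α s ⟨hs.1, hsL⟩ L ⟨hL, le_rfl⟩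
          have h₂ := dist_β 0 ⟨le_rfl, hM⟩ (t - L) hβt
          rw [abs_sub_comm, abs_of_nonneg (sub_nonneg.2 hsL)] at h₁
          rw [abs_sub_comm, sub_zero, abs_of_nonneg hβt.1, hβ₀, ← hα₁] at h₂
          linarith [dist_triangle (α s) (α L) (β (t - L))]
        · rw [right s hsL]
          have h := dist_β (s - L) ⟨by linarith, by linarith [hs.2]⟩ (t - L) hβt
          rwa [sub_sub_sub_cancel_right, abs_sub_comm, abs_of_nonneg (sub_nonneg.2 hst)] at h
    refine LipschitzOnWith.of_dist_le_mul fun s hs t ht => ?_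
    rw [NNReal.coe_one, one_mul, Real.dist_eq]
    rcases le_total s t with hst | hst
    · rw [abs_sub_comm, abs_of_nonneg (sub_nonneg.2 hst)]
      exact ordered s hs t ht hst
    · rw [dist_comm, abs_of_nonneg (sub_nonneg.2 hst)]
      exact ordered t ht s hs hst
  · intro t ht
    rcases le_total t L with htL | htL
    · simp only [left t htL]
      exact hαS ⟨ht.1, htL⟩
    · simp only [right t htL]
      exact hβS ⟨by linarith, by linarith [ht.2]⟩
  · exact (left 0 hL).trans hα₀
  · exact (right (L + M) (by linarith)).trans (by rw [add_sub_cancel_left, hβ₁])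

theorem JoinedByShortPath.map {Y : Type*} [PseudoMetricSpace Y] {S : Set X} {S' : Set Y}
    {f : X → Y} (hf : LipschitzWith 1 f) (hS : MapsTo f S S') {x y : X} {L : ℝ}
    (h : JoinedByShortPath S x y L) : JoinedByShortPath S' (f x) (f y) L := by
  obtain ⟨γ, hγ, hγS, h₀, h₁⟩ := h
  refine ⟨f ∘ γ, ?_, hS.comp hγS, congrArg f h₀, congrArg f h₁⟩
  simpa using hf.comp_lipschitzOnWith hγ

end Paths

section HorosphericalProduct

variable {Y Z : Type*} [MetricSpace Y] [MetricSpace Z]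

/-- Follow a geodesic in the first factor while moving along a vertical geodesic in the second. -/
theorem joinedByShortPath_of_vertParam (hBY : BusemannSpace Y)
    {w : Y} {a : ℝ → Y} (ha : IsRayFrom w a) {w' : Z} {a' : ℝ → Z} {V : ℝ → Z}
    (hV : VertParam w' a' V) (x y : Y) :
    JoinedByShortPath {z | inHoro w a w' a' z}
      (x, V (-height w a x)) (y, V (-height w a y)) (dist x y) := by
  obtain ⟨g, hg, hg₀, hg₁⟩ := hBY.1 x y
  refine ⟨fun t => (g t, V (-height w a (g t))), ?_, ?_, by simp only [hg₀], by simp only [hg₁]⟩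
  · refine LipschitzOnWith.of_dist_le_mul fun s hs t ht => ?_
    rw [NNReal.coe_one, one_mul, Real.dist_eq, ← hg s hs t ht, Prod.dist_eq]
    refine max_le le_rfl ?_
    rw [hV.1 _ (mem_univ _) _ (mem_univ _), neg_sub_neg, abs_sub_comm]
    exact abs_height_sub_le hBY ha _ _
  · intro t _
    simp [inHoro, hV.2]

theorem lN_le_of_lipschitzOnWith (N : AdmNorm) {C : ℝ} (hC : N.BoundConst C) {γ : ℝ → Y × Z}
    {T : ℝ} (hγ : LipschitzOnWith 1 γ (Icc 0 T)) :
    lN N.toFun γ (Icc 0 T) ≤ ENNReal.ofReal (C * T) := by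
  have hC0 : 0 ≤ C := zero_le_one.trans hC.1
  refine iSup_le fun ⟨n, u, hu, huT⟩ => ?_
  have step : ∀ i, N.toFun (dist (γ (u (i + 1))).1 (γ (u i)).1,
      dist (γ (u (i + 1))).2 (γ (u i)).2) ≤ C * (u (i + 1) - u i) := by
    intro i
    have h := hγ.dist_le_mul _ (huT (i + 1)) _ (huT i)
    rw [NNReal.coe_one, one_mul, Real.dist_eq, abs_of_nonneg (sub_nonneg.2 (hu i.le_succ)),
      Prod.dist_eq] at h
    have h₁ := (le_max_left _ _).trans h
    have h₂ := (le_max_right _ _).trans h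
    refine (hC.2 _ _ dist_nonneg dist_nonneg).trans ?_
    nlinarith
  calc _ ≤ ∑ i ∈ Finset.range n, ENNReal.ofReal (C * (u (i + 1) - u i)) :=
        Finset.sum_le_sum fun i _ => ENNReal.ofReal_le_ofReal (step i)
    _ = ENNReal.ofReal (∑ i ∈ Finset.range n, C * (u (i + 1) - u i)) :=
        (ENNReal.ofReal_sum_of_nonneg fun i _ =>
          mul_nonneg hC0 (sub_nonneg.2 (hu i.le_succ))).symm
    _ ≤ ENNReal.ofReal (C * T) := by
        rw [← Finset.mul_sum, Finset.sum_range_sub]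
        gcongr
        linarith [(huT n).2, (huT 0).1]

theorem ofReal_half_dist_add_dist_le_dHN (N : AdmNorm) (mem : Y × Z → Prop) (x y : Y × Z) :
    ENNReal.ofReal ((dist x.1 y.1 + dist x.2 y.2) / 2) ≤ dHN N.toFun mem x y := by
  refine le_iInf fun T => le_iInf fun hT => le_iInf fun γ => le_iInf fun _ => le_iInf fun _ =>
    le_iInf fun h₀ => le_iInf fun h₁ => ?_
  let u : ℕ → ℝ := fun i => if i = 0 then 0 else T
  have hu : Monotone u := by
    refine monotone_nat_of_le_succ fun i => ?_
    by_cases hi : i = 0 <;> simp [u, hi, hT]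
  have huT : ∀ i, u i ∈ Icc 0 T := by
    intro i
    by_cases hi : i = 0 <;> simp [u, hi, hT]
  refine le_trans ?_ (le_iSup (fun p : ℕ × { u : ℕ → ℝ // Monotone u ∧ ∀ i, u i ∈ Icc 0 T } =>
    ∑ i ∈ Finset.range p.1,
      ENNReal.ofReal (N.toFun (dist (γ (p.2.1 (i+1))).1 (γ (p.2.1 i)).1,
        dist (γ (p.2.1 (i+1))).2 (γ (p.2.1 i)).2))) (1, ⟨u, hu, huT⟩))
  simp only [Finset.sum_range_one, u, zero_add, one_ne_zero, if_true, if_false, h₀, h₁]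
  rw [dist_comm x.1, dist_comm x.2]
  exact ENNReal.ofReal_le_ofReal (N.adm _ _)

/-- Two points of the horospherical product are joined by a `1`-Lipschitz path obtained by moving
first along a geodesic of the first factor, then along one of the second factor. -/
theorem exists_joinedByShortPath [ProperSpace Y] [ProperSpace Z]
    (hBY : BusemannSpace Y) (hBZ : BusemannSpace Z)
    (hGY : GeodesicallyComplete Y) (hGZ : GeodesicallyComplete Z)
    {w : Y} {a : ℝ → Y} (ha : IsRayFrom w a) {w' : Z} {a' : ℝ → Z} (ha' : IsRayFrom w' a')
    {x y : Y × Z} (hx : inHoro w a w' a' x) (hy : inHoro w a w' a' y) :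
    ∃ L, 0 ≤ L ∧ L ≤ 2 * dist x.1 y.1 + dist x.2 y.2 ∧
      JoinedByShortPath {z | inHoro w a w' a' z} x y L := by
  obtain ⟨x₁, x₂⟩ := x
  obtain ⟨y₁, y₂⟩ := y
  obtain ⟨V, hV, hVx⟩ := exists_vertParam hBZ hGZ ha' x₂
  obtain ⟨W, hW, hWy⟩ := exists_vertParam hBY hGY ha y₁
  simp only [inHoro] at hx hy
  have hx' : -height w a x₁ = height w' a' x₂ := by linarith
  have hy' : -height w' a' y₂ = height w a y₁ := by linarith
  have hz : -height w' a' (V (-height w a y₁)) = height w a y₁ := by rw [hV.2, neg_neg]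
  have first := joinedByShortPath_of_vertParam hBY ha hV x₁ y₁
  have second := (joinedByShortPath_of_vertParam hBZ ha' hW (V (-height w a y₁)) y₂).map
    (f := Prod.swap) (S' := {z | inHoro w a w' a' z})
    (LipschitzWith.of_dist_le_mul fun p q => by simp [Prod.dist_eq, max_comm])
    (fun p hp => by simpa [inHoro, add_comm] using hp)
  rw [hx', hVx] at first
  rw [hz, hy', hWy] at second
  refine ⟨_, add_nonneg dist_nonneg dist_nonneg, ?_, first.trans dist_nonneg dist_nonneg second⟩
  have hd : dist (V (-height w a y₁)) x₂ ≤ dist x₁ y₁ := by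
    conv_lhs => rw [← hVx, ← hx', hV.1 _ (mem_univ _) _ (mem_univ _), neg_sub_neg]
    exact abs_height_sub_le hBY ha _ _
  dsimp only
  linarith [dist_triangle (V (-height w a y₁)) x₂ y₂]

end HorosphericalProduct

/-- The horospherical product is connected: any two of its points are
joined by a path of controlled `N`-length, and the `N`-path metric is comparable
with `d_{H_p} + d_{H_q}`. -/
theorem statement10 {Hp Hq : Type*} [MetricSpace Hp] [MetricSpace Hq]
    [ProperSpace Hp] [ProperSpace Hq]
    (δ : ℝ) (hδ : 1 ≤ δ)
    (hHp : DeltaHyperbolic Hp δ) (hHq : DeltaHyperbolic Hq δ)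
    (hBp : BusemannSpace Hp) (hBq : BusemannSpace Hq)
    (hGp : GeodesicallyComplete Hp) (hGq : GeodesicallyComplete Hq)
    (wp : Hp) (ap : ℝ → Hp) (hap : IsRayFrom wp ap)
    (wq : Hq) (aq : ℝ → Hq) (haq : IsRayFrom wq aq)
    (N : AdmNorm) (CN : ℝ) (hCN : N.BoundConst CN)
    (x y : Hp × Hq) (hx : inHoro wp ap wq aq x) (hy : inHoro wp ap wq aq y) :
    (∃ (T : ℝ) (γ : ℝ → Hp × Hq), 0 ≤ T ∧ ContinuousOn γ (Set.Icc 0 T) ∧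
      (∀ t ∈ Set.Icc (0:ℝ) T, inHoro wp ap wq aq (γ t)) ∧ γ 0 = x ∧ γ T = y ∧
      lN N.toFun γ (Set.Icc 0 T)
        ≤ ENNReal.ofReal (2 * CN * (dist x.1 y.1 + dist x.2 y.2))) ∧
    ENNReal.ofReal ((dist x.1 y.1 + dist x.2 y.2) / 2)
      ≤ dHN N.toFun (inHoro wp ap wq aq) x y ∧
    dHN N.toFun (inHoro wp ap wq aq) x y
      ≤ ENNReal.ofReal (2 * CN * (dist x.1 y.1 + dist x.2 y.2)) := by
  have hC0 : 0 ≤ CN := zero_le_one.trans hCN.1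
  obtain ⟨T, hT, hTle, γ, hγ, hmem, h₀, h₁⟩ :=
    exists_joinedByShortPath hBp hBq hGp hGq hap haq hx hy
  have hlen : lN N.toFun γ (Icc 0 T)
      ≤ ENNReal.ofReal (2 * CN * (dist x.1 y.1 + dist x.2 y.2)) := by
    refine (lN_le_of_lipschitzOnWith N hCN hγ).trans (ENNReal.ofReal_le_ofReal ?_)
    have hq : 0 ≤ dist x.2 y.2 := dist_nonneg
    calc CN * T ≤ CN * (2 * (dist x.1 y.1 + dist x.2 y.2)) := by gcongr; linarith
      _ = 2 * CN * (dist x.1 y.1 + dist x.2 y.2) := by ring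
  refine ⟨⟨T, γ, hT, hγ.continuousOn, hmem, h₀, h₁, hlen⟩,
    ofReal_half_dist_add_dist_le_dHN N _ x y, ?_⟩
  exact iInf_le_of_le T <| iInf_le_of_le hT <| iInf_le_of_le γ <|
    iInf_le_of_le hγ.continuousOn <| iInf_le_of_le hmem <| iInf_le_of_le h₀ <|
    iInf_le_of_le h₁ hlen

end HP

end
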